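/- arXiv:1705.04072 — 3 statements merged into one kernel-verified Lean document; each statement's English description precedes it below -/
import Mathlib

section
/- Let n ≥ 1, let E^n denote n-dimensional real Euclidean space, let A : E^n → E^n be a linear map, let ε > 0, and let v ∈ E^n with ‖v‖ = 1. Then there exists a linear map Q : E^n → E^n such that ‖Q − id‖ ≤ ε and ‖A(Q(v))‖ ≥ ε · n^(−3/2) · ‖A‖, where ‖·‖ denotes the operator norm on linear maps. -/
/-- A continuous linear map on a proper real normed space attains its norm on the unit ball. -/
theorem ContinuousLinearMap.exists_norm_le_one_opNorm_le {E F : Type*}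
    [NormedAddCommGroup E] [NormedSpace ℝ E] [ProperSpace E]
    [NormedAddCommGroup F] [NormedSpace ℝ F] (A : E →L[ℝ] F) :
    ∃ w : E, ‖w‖ ≤ 1 ∧ ‖A‖ ≤ ‖A w‖ := by
  obtain ⟨w, hw, hmax⟩ := (isCompact_closedBall (0 : E) 1).exists_isMaxOn
    ⟨0, by simp⟩ (f := fun x => ‖A x‖) (by fun_prop)
  refine ⟨w, by simpa using hw, A.opNorm_le_of_unit_norm (norm_nonneg _) fun x hx => ?_⟩
  exact hmax (by simp [hx])

/-- Any unit vector `v` can be moved by a perturbation of the identity of size at most `ε` to a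
vector whose image under `A` has norm at least `ε * ‖A‖`. -/
theorem ContinuousLinearMap.exists_norm_sub_id_le_and_mul_opNorm_le {E F : Type*}
    [NormedAddCommGroup E] [InnerProductSpace ℝ E] [ProperSpace E]
    [NormedAddCommGroup F] [NormedSpace ℝ F] (A : E →L[ℝ] F)
    {ε : ℝ} (hε : 0 ≤ ε) {v : E} (hv : ‖v‖ = 1) :
    ∃ Q : E →L[ℝ] E, ‖Q - ContinuousLinearMap.id ℝ E‖ ≤ ε ∧ ε * ‖A‖ ≤ ‖A (Q v)‖ := by
  obtain ⟨w, hw, hAw⟩ := A.exists_norm_le_one_opNorm_le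
  have perturb (t : ℝ) (ht : |t| = ε) (h : ε * ‖A‖ ≤ ‖A v + t • A w‖) :
      ∃ Q : E →L[ℝ] E, ‖Q - ContinuousLinearMap.id ℝ E‖ ≤ ε ∧ ε * ‖A‖ ≤ ‖A (Q v)‖ := by
    refine ⟨ContinuousLinearMap.id ℝ E + (innerSL ℝ v).smulRight (t • w), ?_, ?_⟩
    · rw [add_sub_cancel_left, ContinuousLinearMap.norm_smulRight_apply, innerSL_apply_norm, hv,
        one_mul, norm_smul, Real.norm_eq_abs, ht]
      exact mul_le_of_le_one_right hε hw
    · simpa [real_inner_self_eq_norm_sq, hv] using h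
  have hsum : 2 * (ε * ‖A‖) ≤ ‖A v + ε • A w‖ + ‖A v + (-ε) • A w‖ := calc
    2 * (ε * ‖A‖) ≤ 2 * (ε * ‖A w‖) := by gcongr
    _ = ‖(A v + ε • A w) - (A v + (-ε) • A w)‖ := by
      rw [show (A v + ε • A w) - (A v + (-ε) • A w) = (2 * ε) • A w by module, norm_smul,
        Real.norm_of_nonneg (by positivity), mul_assoc]
    _ ≤ _ := norm_sub_le _ _
  rcases le_total (ε * ‖A‖) ‖A v + ε • A w‖ with h | h
  · exact perturb ε (abs_of_nonneg hε) h
  · exact perturb (-ε) (by rw [abs_neg, abs_of_nonneg hε]) (by linarith)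


/-- Mañé's perturbation lemma (Mañé, page 528): for any linear map `A` on
`n`-dimensional Euclidean space, any `ε > 0` and any unit vector `v`, there is a
linear map `Q` with `‖Q - id‖ ≤ ε` and `‖A (Q v)‖ ≥ ε · n^(-3/2) · ‖A‖`. -/
theorem mane_perturbation_lemma (n : ℕ) (hn : 1 ≤ n)
    (A : EuclideanSpace ℝ (Fin n) →L[ℝ] EuclideanSpace ℝ (Fin n))
    (ε : ℝ) (hε : 0 < ε) (v : EuclideanSpace ℝ (Fin n)) (hv : ‖v‖ = 1) :
    ∃ Q : EuclideanSpace ℝ (Fin n) →L[ℝ] EuclideanSpace ℝ (Fin n),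
      ‖Q - ContinuousLinearMap.id ℝ (EuclideanSpace ℝ (Fin n))‖ ≤ ε ∧
      ‖A (Q v)‖ ≥ ε * (n : ℝ) ^ (-(3/2 : ℝ)) * ‖A‖ := by
  obtain ⟨Q, hQ, hAQ⟩ := A.exists_norm_sub_id_le_and_mul_opNorm_le hε.le hv
  refine ⟨Q, hQ, le_trans ?_ hAQ⟩
  gcongr
  exact mul_le_of_le_one_right hε.le
    (Real.rpow_le_one_of_one_le_of_nonpos (by exact_mod_cast hn) (by norm_num))
end

section
/- Let n ≥ 1, let A : E^n → E^n be linear, let ε > 0, and let v ∈ E^n with ‖v‖ = 1 and |v_1| ≥ n^(−1/2), and suppose i, j ∈ {1, …, n} satisfy ‖A‖ ≤ n · |a_{ji}| where a_{ji} = (A e_i)_j. Then there exists t ∈ {−1, 1} such that the linear map Q : E^n → E^n defined by Q(w) = w + ε·t·w_1·e_i satisfies ‖Q − id‖ ≤ ε and ‖A(Q(v))‖ ≥ ε · |a_{ji}| · |v_1| ≥ ε · n^(−3/2) · ‖A‖. -/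
theorem exists_sign_abs_le_abs_add_mul (x y : ℝ) :
    ∃ t : ℝ, (t = 1 ∨ t = -1) ∧ |x| ≤ |y + t * x| := by
  rcases le_total 0 (y * x) with h | h
  · exact ⟨1, Or.inl rfl, sq_le_sq.mp (by nlinarith [sq_nonneg y])⟩
  · exact ⟨-1, Or.inr rfl, sq_le_sq.mp (by nlinarith [sq_nonneg y])⟩


/-- The explicit construction in the proof of Mañé's perturbation lemma: given
a unit vector `v` whose first coordinate satisfies `|v_1| ≥ n^(-1/2)` and
indices `i, j` with `‖A‖ ≤ n · |a_{ji}|` (where `a_{ji} = (A e_i)_j`), there is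
a sign `t ∈ {-1, 1}` such that the linear map `Q w = w + ε t w_1 e_i` satisfies
`‖Q - id‖ ≤ ε` and `‖A (Q v)‖ ≥ ε |a_{ji}| |v_1| ≥ ε n^(-3/2) ‖A‖`. -/
theorem mane_explicit_perturbation (n : ℕ) (hn : 1 ≤ n)
    (A : EuclideanSpace ℝ (Fin n) →L[ℝ] EuclideanSpace ℝ (Fin n))
    (ε : ℝ) (hε : 0 < ε) (v : EuclideanSpace ℝ (Fin n)) (hv : ‖v‖ = 1)
    (hv1 : |v ⟨0, hn⟩| ≥ (n : ℝ) ^ (-(1/2 : ℝ)))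
    (i j : Fin n)
    (hij : ‖A‖ ≤ (n : ℝ) * |A (EuclideanSpace.single i (1 : ℝ)) j|) :
    ∃ t : ℝ, (t = 1 ∨ t = -1) ∧
      ∃ Q : EuclideanSpace ℝ (Fin n) →L[ℝ] EuclideanSpace ℝ (Fin n),
        (∀ w, Q w = w + (ε * t * w ⟨0, hn⟩) • EuclideanSpace.single i (1 : ℝ)) ∧
        ‖Q - ContinuousLinearMap.id ℝ (EuclideanSpace ℝ (Fin n))‖ ≤ ε ∧
        ‖A (Q v)‖ ≥ ε * |A (EuclideanSpace.single i (1 : ℝ)) j| * |v ⟨0, hn⟩| ∧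
        ε * |A (EuclideanSpace.single i (1 : ℝ)) j| * |v ⟨0, hn⟩| ≥
          ε * (n : ℝ) ^ (-(3/2 : ℝ)) * ‖A‖ := by
  set a := A (EuclideanSpace.single i (1 : ℝ)) j with ha
  obtain ⟨t, ht, h⟩ := exists_sign_abs_le_abs_add_mul (ε * a * v ⟨0, hn⟩) (A v j)
  have ht' : |t| = 1 := by rcases ht with rfl | rfl <;> simp
  refine ⟨t, ht, ContinuousLinearMap.id ℝ _ + (ε * t) •
    (EuclideanSpace.proj (⟨0, hn⟩ : Fin n) : EuclideanSpace ℝ (Fin n) →L[ℝ] ℝ).smulRight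
      (EuclideanSpace.single i (1 : ℝ)), ?_, ?_, ?_, ?_⟩
  · intro w
    simp [smul_smul]
  · refine ContinuousLinearMap.opNorm_le_bound _ hε.le fun w => ?_
    have hw := PiLp.norm_apply_le w ⟨0, hn⟩
    simpa [norm_smul, ht', abs_of_pos hε] using mul_le_mul_of_nonneg_left hw hε.le
  · refine le_trans ?_ (PiLp.norm_apply_le _ j)
    rw [abs_mul, abs_mul, abs_of_pos hε] at h
    refine h.trans (le_of_eq ?_)
    simp only [Real.norm_eq_abs, add_apply, ContinuousLinearMap.id_apply,
      smul_apply, ContinuousLinearMap.smulRight_apply, map_add, map_smul,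
      PiLp.add_apply, PiLp.smul_apply, smul_eq_mul, PiLp.proj_apply, ← ha]
    ring_nf
  · have hn0 : (0 : ℝ) < n := by exact_mod_cast hn
    have hpow : (n : ℝ) ^ (-(3 / 2 : ℝ)) * n = (n : ℝ) ^ (-(1 / 2 : ℝ)) := by
      rw [← Real.rpow_add_one hn0.ne']
      norm_num
    calc ε * (n : ℝ) ^ (-(3 / 2 : ℝ)) * ‖A‖
        ≤ ε * (n : ℝ) ^ (-(3 / 2 : ℝ)) * (n * |a|) := by gcongr
      _ = ε * |a| * (n : ℝ) ^ (-(1 / 2 : ℝ)) := by rw [← hpow]; ring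
      _ ≤ ε * |a| * |v ⟨0, hn⟩| := by gcongr
end

section
/- Let n ≥ 1, let ε > 0, and let B_0, B_1, …, B_{ℓ−1} : E^n → E^n be linear maps (ℓ ≥ 1). Then there exist a vector v ∈ E^n with ‖v‖ = 1 and ‖B_0 v‖ = ‖B_0‖, and linear maps Q_1, …, Q_{ℓ−1} : E^n → E^n with ‖Q_i − id‖ ≤ ε for every i, such that ‖(B_{ℓ−1} ∘ Q_{ℓ−1} ∘ ⋯ ∘ B_1 ∘ Q_1 ∘ B_0)(v)‖ ≥ (ε · n^(−3/2))^(ℓ−1) · ∏_{i=0}^{ℓ−1} ‖B_i‖. -/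
open Metric in
/-- A continuous linear map on a nontrivial finite-dimensional space attains its operator norm
at a unit vector. -/
theorem exists_norm_eq_one_norm_apply_eq_opNorm {E F : Type*} [NormedAddCommGroup E]
    [NormedSpace ℝ E] [FiniteDimensional ℝ E] [Nontrivial E] [NormedAddCommGroup F]
    [NormedSpace ℝ F] (A : E →L[ℝ] F) : ∃ u : E, ‖u‖ = 1 ∧ ‖A u‖ = ‖A‖ := by
  have : ProperSpace E := FiniteDimensional.proper ℝ E
  obtain ⟨u, hu, hmax⟩ := (isCompact_sphere (0 : E) 1).exists_isMaxOn
    (NormedSpace.sphere_nonempty.2 zero_le_one) (A.continuous.norm.continuousOn)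
  rw [mem_sphere_zero_iff_norm] at hu
  refine ⟨u, hu, le_antisymm ?_ ?_⟩
  · simpa [hu] using A.le_opNorm u
  · exact A.opNorm_le_of_unit_norm (norm_nonneg _) fun x hx =>
      hmax (mem_sphere_zero_iff_norm.2 hx)

/-- One of `a + b`, `a - b` is at least as long as `b`. -/
theorem norm_le_norm_add_or_norm_sub {E : Type*} [NormedAddCommGroup E] [NormedSpace ℝ E]
    (a b : E) : ‖b‖ ≤ ‖a + b‖ ∨ ‖b‖ ≤ ‖a - b‖ := by
  by_contra! h
  have h2 : ‖(2 : ℝ) • b‖ ≤ ‖a + b‖ + ‖a - b‖ := by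
    rw [show (2 : ℝ) • b = (a + b) - (a - b) by rw [two_smul]; abel]
    exact norm_sub_le _ _
  rw [norm_smul, Real.norm_two] at h2
  linarith [h.1, h.2]

/-- A perturbation of the identity of size `ε` can turn a vector `w` so that its image under `A`
has length at least `ε * ‖A‖ * ‖w‖`. -/
theorem exists_perturbation_le_norm_apply {E F : Type*} [NormedAddCommGroup E]
    [InnerProductSpace ℝ E] [FiniteDimensional ℝ E] [Nontrivial E] [NormedAddCommGroup F]
    [NormedSpace ℝ F] {ε : ℝ} (hε : 0 ≤ ε) (A : E →L[ℝ] F) (w : E) :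
    ∃ Q : E →L[ℝ] E, ‖Q - ContinuousLinearMap.id ℝ E‖ ≤ ε ∧ ε * ‖A‖ * ‖w‖ ≤ ‖A (Q w)‖ := by
  rcases eq_or_ne w 0 with rfl | hw
  · exact ⟨ContinuousLinearMap.id ℝ E, by simpa using hε, by simp⟩
  obtain ⟨u, hu, hAu⟩ := exists_norm_eq_one_norm_apply_eq_opNorm A
  have hw' : ‖w‖ ≠ 0 := norm_ne_zero_iff.2 hw
  let R : E →L[ℝ] E := (innerSL ℝ ((ε / ‖w‖) • w)).smulRight u
  have hR : ‖R‖ ≤ ε := by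
    simp only [R, ContinuousLinearMap.norm_smulRight_apply, innerSL_apply_norm, norm_smul, hu,
      norm_div, norm_norm, Real.norm_of_nonneg hε, mul_one]
    rw [div_mul_cancel₀ _ hw']
  have hRw : R w = (ε * ‖w‖) • u := by
    simp only [R, ContinuousLinearMap.smulRight_apply, innerSL_apply_apply, real_inner_smul_left,
      real_inner_self_eq_norm_sq]
    congr 1
    field_simp
  have hARw : ‖A (R w)‖ = ε * ‖A‖ * ‖w‖ := by
    rw [hRw, map_smul, norm_smul, hAu, Real.norm_of_nonneg (by positivity)]
    ring
  rcases norm_le_norm_add_or_norm_sub (A w) (A (R w)) with h | h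
  · exact ⟨ContinuousLinearMap.id ℝ E + R, by simpa using hR, by simpa [← hARw] using h⟩
  · exact ⟨ContinuousLinearMap.id ℝ E - R, by simpa using hR, by simpa [← hARw] using h⟩


/-- The alternating composition `B_k ∘ Q_k ∘ ⋯ ∘ B_1 ∘ Q_1 ∘ B_0`. -/
noncomputable def chainComp {n : ℕ}
    (B Q : ℕ → (EuclideanSpace ℝ (Fin n) →L[ℝ] EuclideanSpace ℝ (Fin n))) :
    ℕ → (EuclideanSpace ℝ (Fin n) →L[ℝ] EuclideanSpace ℝ (Fin n))
  | 0 => B 0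
  | (k + 1) => (B (k + 1)).comp ((Q (k + 1)).comp (chainComp B Q k))

/-- The inductive product estimate (inequalities (1)–(3) of the paper): given
linear maps `B_0, …, B_{ℓ-1}` on `n`-dimensional Euclidean space and `ε > 0`,
there are a unit vector `v` with `‖B_0 v‖ = ‖B_0‖` and perturbations
`Q_1, …, Q_{ℓ-1}` with `‖Q_i - id‖ ≤ ε`, such that
`‖(B_{ℓ-1} ∘ Q_{ℓ-1} ∘ ⋯ ∘ B_1 ∘ Q_1 ∘ B_0) v‖ ≥ (ε n^(-3/2))^(ℓ-1) ∏ ‖B_i‖`. -/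
theorem chain_product_estimate (n : ℕ) (hn : 1 ≤ n) (ε : ℝ) (hε : 0 < ε)
    (ℓ : ℕ) (hℓ : 1 ≤ ℓ)
    (B : ℕ → (EuclideanSpace ℝ (Fin n) →L[ℝ] EuclideanSpace ℝ (Fin n))) :
    ∃ v : EuclideanSpace ℝ (Fin n), ‖v‖ = 1 ∧ ‖B 0 v‖ = ‖B 0‖ ∧
      ∃ Q : ℕ → (EuclideanSpace ℝ (Fin n) →L[ℝ] EuclideanSpace ℝ (Fin n)),
        (∀ i, 1 ≤ i → i ≤ ℓ - 1 →
          ‖Q i - ContinuousLinearMap.id ℝ (EuclideanSpace ℝ (Fin n))‖ ≤ ε) ∧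
        ‖chainComp B Q (ℓ - 1) v‖ ≥
          (ε * (n : ℝ) ^ (-(3/2 : ℝ))) ^ (ℓ - 1) *
            ∏ i ∈ Finset.range ℓ, ‖B i‖ := by
  have : Nonempty (Fin n) := ⟨⟨0, hn⟩⟩
  obtain ⟨v, hv, hBv⟩ := exists_norm_eq_one_norm_apply_eq_opNorm (B 0)
  refine ⟨v, hv, hBv, ?_⟩
  choose q hq hqB using fun (i : ℕ) (w : EuclideanSpace ℝ (Fin n)) =>
    exists_perturbation_le_norm_apply hε.le (B i) w
  let w : ℕ → EuclideanSpace ℝ (Fin n) :=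
    fun k => Nat.rec (B 0 v) (fun k x => B (k + 1) (q (k + 1) x x)) k
  let Q : ℕ → (EuclideanSpace ℝ (Fin n) →L[ℝ] EuclideanSpace ℝ (Fin n)) :=
    fun i => q i (w (i - 1))
  have hw : ∀ k, chainComp B Q k v = w k := by
    intro k
    induction k with
    | zero => rfl
    | succ k ih =>
      simp only [chainComp, ContinuousLinearMap.comp_apply, ih]
      rfl
  have hc : ε * (n : ℝ) ^ (-(3/2 : ℝ)) ≤ ε :=
    mul_le_of_le_one_right hε.le
      (Real.rpow_le_one_of_one_le_of_nonpos (by exact_mod_cast hn) (by norm_num))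
  have hc0 : 0 ≤ ε * (n : ℝ) ^ (-(3/2 : ℝ)) := by positivity
  have hmain : ∀ k, (ε * (n : ℝ) ^ (-(3/2 : ℝ))) ^ k * ∏ i ∈ Finset.range (k + 1), ‖B i‖
      ≤ ‖w k‖ := by
    intro k
    induction k with
    | zero => simpa [w] using hBv.ge
    | succ k ih =>
      rw [Finset.prod_range_succ, pow_succ]
      calc _ = (ε * (n : ℝ) ^ (-(3/2 : ℝ))) * ‖B (k + 1)‖ *
            ((ε * (n : ℝ) ^ (-(3/2 : ℝ))) ^ k * ∏ i ∈ Finset.range (k + 1), ‖B i‖) := by ring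
        _ ≤ ε * ‖B (k + 1)‖ * ‖w k‖ :=
            mul_le_mul (mul_le_mul_of_nonneg_right hc (norm_nonneg _)) ih
              (mul_nonneg (pow_nonneg hc0 k) (Finset.prod_nonneg fun _ _ => norm_nonneg _))
              (mul_nonneg hε.le (norm_nonneg _))
        _ ≤ ‖w (k + 1)‖ := hqB (k + 1) (w k)
  refine ⟨Q, fun i _ _ => hq i _, ?_⟩
  have h := hmain (ℓ - 1)
  rw [Nat.sub_add_cancel hℓ] at h
  rw [hw]
  exact h
end
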